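/- Let G be a natural unit interval graph on {1,…,n} and let φ_G: HT(G) → HT(G) be the map sending T to itself if T has no movable entry and to T^j if T has smallest movable entry j. Then for every T ∈ HT(G): φ_G(φ_G(T)) = T and inv φ_G(T) = inv T; if T is a fixed point of φ_G then sgn T = 1 (indeed T has column shape 1^n); and if T is not a fixed point then sgn φ_G(T) = −sgn T. -/

import Mathlib

open Finset
open scoped Classical

noncomputable section

/-- `G` is a natural unit interval graph. -/
def IsNUIG {n : ℕ} (G : SimpleGraph (Fin n)) : Prop :=
  ∀ i j k : Fin n, i < j → j < k → G.Adj i k → G.Adj i j ∧ G.Adj j k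

/-- A hook-shaped `G`-tableau, encoded by the bijective map sending each entry
`v : Fin n` to its cell `(row, column)` (0-indexed, English notation).
The conditions say: the filling is injective, every cell lies in the first row
or the first column, the occupied cells of the first row and first column form
initial segments (so the shape is a hook diagram `(k, 1^(n-k))`), rows satisfy
(C1): left neighbour `i` of `j` has `i < j` and `ij ∉ E`, and columns satisfy
(C2): upper neighbour `i` of `j` has `i < j` or `ij ∈ E`. -/
def IsHookTab {n : ℕ} (G : SimpleGraph (Fin n))
    (f : Fin n → Fin (n + 1) × Fin (n + 1)) : Prop :=
  Function.Injective f ∧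
  (∀ v, ((f v).1 : ℕ) = 0 ∨ ((f v).2 : ℕ) = 0) ∧
  (∀ v, ((f v).1 : ℕ) = 0 → 0 < ((f v).2 : ℕ) →
    ∃ u, ((f u).1 : ℕ) = 0 ∧ ((f u).2 : ℕ) + 1 = ((f v).2 : ℕ)) ∧
  (∀ v, ((f v).2 : ℕ) = 0 → 0 < ((f v).1 : ℕ) →
    ∃ u, ((f u).2 : ℕ) = 0 ∧ ((f u).1 : ℕ) + 1 = ((f v).1 : ℕ)) ∧
  (∀ u v, ((f u).1 : ℕ) = 0 → ((f v).1 : ℕ) = 0 →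
    ((f v).2 : ℕ) = ((f u).2 : ℕ) + 1 → u < v ∧ ¬ G.Adj u v) ∧
  (∀ u v, ((f u).2 : ℕ) = 0 → ((f v).2 : ℕ) = 0 →
    ((f v).1 : ℕ) = ((f u).1 : ℕ) + 1 → u < v ∨ G.Adj u v)

/-- The entry `v` lies in the arm (first row, excluding the corner cell). -/
def InArm {n : ℕ} (f : Fin n → Fin (n + 1) × Fin (n + 1)) (v : Fin n) : Prop :=
  ((f v).1 : ℕ) = 0 ∧ ((f v).2 : ℕ) ≠ 0

/-- The entry `v` lies in the leg (first column, excluding the corner cell). -/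
def InLeg {n : ℕ} (f : Fin n → Fin (n + 1) × Fin (n + 1)) (v : Fin n) : Prop :=
  ((f v).2 : ℕ) = 0 ∧ ((f v).1 : ℕ) ≠ 0

/-- The set of inversions of a tableau: pairs `(i,j)` with `i < j`, `ij ∈ E`,
and `i` in a lower row than `j`. -/
def InvSet {n : ℕ} (G : SimpleGraph (Fin n))
    (f : Fin n → Fin (n + 1) × Fin (n + 1)) : Finset (Fin n × Fin n) :=
  Finset.univ.filter fun p =>
    p.1 < p.2 ∧ G.Adj p.1 p.2 ∧ ((f p.2).1 : ℕ) < ((f p.1).1 : ℕ)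

/-- `g` is obtained from `f` by moving the entry `j` (between the arm and leg),
keeping all other entries in their regions and relative order, so that `g` is
again a `G`-tableau with the same inversion set. -/
def MoveCore {n : ℕ} (G : SimpleGraph (Fin n))
    (f g : Fin n → Fin (n + 1) × Fin (n + 1)) (j : Fin n) : Prop :=
  IsHookTab G g ∧
  (∀ u, u ≠ j → ((InArm f u ↔ InArm g u) ∧ (InLeg f u ↔ InLeg g u))) ∧
  (∀ u u', u ≠ j → u' ≠ j → InArm f u → InArm f u' →
    (((f u).2 : ℕ) < ((f u').2 : ℕ) ↔ ((g u).2 : ℕ) < ((g u').2 : ℕ))) ∧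
  (∀ u u', u ≠ j → u' ≠ j → InLeg f u → InLeg f u' →
    (((f u).1 : ℕ) < ((f u').1 : ℕ) ↔ ((g u).1 : ℕ) < ((g u').1 : ℕ))) ∧
  InvSet G g = InvSet G f

/-- `g` is the result of moving the arm entry `j` of `f` to the leg. -/
def ArmToLeg {n : ℕ} (G : SimpleGraph (Fin n))
    (f g : Fin n → Fin (n + 1) × Fin (n + 1)) (j : Fin n) : Prop :=
  InArm f j ∧ InLeg g j ∧ MoveCore G f g j

/-- `g` is the result of moving the leg entry `j` of `f` to the arm. -/
def LegToArm {n : ℕ} (G : SimpleGraph (Fin n))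
    (f g : Fin n → Fin (n + 1) × Fin (n + 1)) (j : Fin n) : Prop :=
  InLeg f j ∧ InArm g j ∧ MoveCore G f g j

/-- The entry `j` is movable. -/
def MovableEntry {n : ℕ} (G : SimpleGraph (Fin n))
    (f : Fin n → Fin (n + 1) × Fin (n + 1)) (j : Fin n) : Prop :=
  (∃ g, ArmToLeg G f g j) ∨ (∃ g, LegToArm G f g j)

/-- `HT n G`: the type of hook-shaped `G`-tableaux. -/
abbrev HT (n : ℕ) (G : SimpleGraph (Fin n)) :=
  {f : Fin n → Fin (n + 1) × Fin (n + 1) // IsHookTab G f}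

lemma MovableEntry.exists_tab {n : ℕ} {G : SimpleGraph (Fin n)}
    {f : Fin n → Fin (n + 1) × Fin (n + 1)} {j : Fin n} (h : MovableEntry G f j) :
    ∃ g, IsHookTab G g ∧ (ArmToLeg G f g j ∨ LegToArm G f g j) := by
  rcases h with ⟨g, hg⟩ | ⟨g, hg⟩
  · exact ⟨g, hg.2.2.1, Or.inl hg⟩
  · exact ⟨g, hg.2.2.1, Or.inr hg⟩

/-- The involution `φ_G`: if `T` has a movable entry, move the smallest movable
entry `j` (producing `T^j`); otherwise fix `T`. -/
noncomputable def phi {n : ℕ} {G : SimpleGraph (Fin n)} (T : HT n G) : HT n G :=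
  if h : (Finset.univ.filter fun j : Fin n => MovableEntry G T.1 j).Nonempty then
    have hj : MovableEntry G T.1
        ((Finset.univ.filter fun j : Fin n => MovableEntry G T.1 j).min' h) :=
      (Finset.mem_filter.mp (Finset.min'_mem _ h)).2
    ⟨Classical.choose hj.exists_tab, (Classical.choose_spec hj.exists_tab).1⟩
  else T

/-- The number of arm entries of `T`; the shape of `T` is `(k, 1^(n-k))` with
`k = armCard T + 1`. -/
def armCard {n : ℕ} {G : SimpleGraph (Fin n)} (T : HT n G) : ℕ :=
  (Finset.univ.filter fun v => InArm T.1 v).card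

/-- The sign `(-1)^(k-1)` of a hook tableau of shape `(k, 1^(n-k))`. -/
def tabSign {n : ℕ} {G : SimpleGraph (Fin n)} (T : HT n G) : ℤ :=
  (-1) ^ armCard T

/-- The number of inversions of `T`. -/
def tabInv {n : ℕ} (G : SimpleGraph (Fin n)) (T : HT n G) : ℕ :=
  (InvSet G T.1).card

/-- The `q`-integer `[k]_q = 1 + q + ⋯ + q^(k-1)` in `ℤ[q]`. -/
def qInt (k : ℕ) : Polynomial ℤ := ∑ i ∈ Finset.range k, Polynomial.X ^ i

/-- `b_k`: the number of neighbours of `k` smaller than `k`. -/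
def smallerNbrs {n : ℕ} (G : SimpleGraph (Fin n)) (k : Fin n) : ℕ :=
  (Finset.univ.filter fun i : Fin n => i < k ∧ G.Adj i k).card

/-- `r` is an orientation of `G`: every arc is an edge and every edge gets
exactly one direction. -/
def IsOrientation {V : Type*} (G : SimpleGraph V) (r : V → V → Prop) : Prop :=
  (∀ u v, r u v → G.Adj u v) ∧ (∀ u v, G.Adj u v → (r u v ↔ ¬ r v u))

/-- `r` is an acyclic orientation of `G`. -/
def IsAcyclicOrientation {V : Type*} (G : SimpleGraph V) (r : V → V → Prop) : Prop :=
  IsOrientation G r ∧ ∀ v, ¬ Relation.TransGen r v v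

/-- `v` is a sink: it has no outgoing arc. -/
def IsSinkOf {V : Type*} (r : V → V → Prop) (v : V) : Prop := ∀ u, ¬ r v u

/-- `f` is a `G`-tableau of column shape `1^n`. -/
def IsColTab {n : ℕ} (G : SimpleGraph (Fin n))
    (f : Fin n → Fin (n + 1) × Fin (n + 1)) : Prop :=
  IsHookTab G f ∧ ∀ v, ((f v).2 : ℕ) = 0

/-- The orientation `ψ(T)` associated to a column tableau: each edge is directed
from the entry occurring lower in `T` to the entry occurring higher. -/
def psi {n : ℕ} (G : SimpleGraph (Fin n))
    (f : Fin n → Fin (n + 1) × Fin (n + 1)) : Fin n → Fin n → Prop :=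
  fun u v => G.Adj u v ∧ ((f v).1 : ℕ) < ((f u).1 : ℕ)

end

/-- The strict order of the poset associated with `G`. -/
def PLt {n : ℕ} (G : SimpleGraph (Fin n)) (u v : Fin n) : Prop := u < v ∧ ¬ G.Adj u v

lemma PLt.trans' {n : ℕ} {G : SimpleGraph (Fin n)} (hG : IsNUIG G) {u v w : Fin n}
    (h1 : PLt G u v) (h2 : PLt G v w) : PLt G u w :=
  ⟨h1.1.trans h2.1, fun h => h1.2 (hG u v w h1.1 h2.1 h).1⟩

lemma PLt.asymm' {n : ℕ} {G : SimpleGraph (Fin n)} {u v : Fin n}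
    (h1 : PLt G u v) (h2 : PLt G v u) : False := lt_asymm h1.1 h2.1

/-- index of `v` in `S` according to the key `κ`. -/
def idx {n : ℕ} (S : Finset (Fin n)) (κ : Fin n → ℕ) (v : Fin n) : ℕ :=
  (S.filter fun u => κ u < κ v).card

lemma idx_le {n : ℕ} (S : Finset (Fin n)) (κ : Fin n → ℕ) (v : Fin n) : idx S κ v < n + 1 := by
  have := Finset.card_le_univ (S.filter fun u => κ u < κ v)
  simp only [Fintype.card_fin] at this
  unfold idx; omega

lemma idx_mono {n : ℕ} (S : Finset (Fin n)) (κ : Fin n → ℕ) {u v : Fin n} (hu : u ∈ S)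
    (h : κ u < κ v) : idx S κ u < idx S κ v := by
  unfold idx
  apply Finset.card_lt_card
  rw [Finset.ssubset_iff_of_subset]
  · exact ⟨u, by simp [hu, h], by simp⟩
  · intro w hw
    simp only [Finset.mem_filter] at hw ⊢
    exact ⟨hw.1, hw.2.trans h⟩

lemma idx_lt_iff {n : ℕ} (S : Finset (Fin n)) (κ : Fin n → ℕ) {u v : Fin n} (hu : u ∈ S)
    (hv : v ∈ S) : idx S κ u < idx S κ v ↔ κ u < κ v := by
  refine ⟨fun h => ?_, idx_mono S κ hu⟩
  rcases lt_trichotomy (κ u) (κ v) with h1 | h1 | h1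
  · exact h1
  · unfold idx at h; rw [h1] at h; exact absurd h (lt_irrefl _)
  · have := idx_mono S κ hv h1; omega

lemma idx_pred {n : ℕ} (S : Finset (Fin n)) (κ : Fin n → ℕ)
    (hκ : ∀ u ∈ S, ∀ v ∈ S, κ u = κ v → u = v) {v : Fin n}
    (h : 0 < idx S κ v) : ∃ u ∈ S, idx S κ u + 1 = idx S κ v := by
  obtain ⟨u, hu, hmax⟩ := Finset.exists_max_image (S.filter fun u => κ u < κ v) κ
    (Finset.card_pos.mp h)
  simp only [Finset.mem_filter] at hu hmax
  refine ⟨u, hu.1, ?_⟩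
  unfold idx
  have : (S.filter fun w => κ w < κ v) = insert u (S.filter fun w => κ w < κ u) := by
    ext w
    simp only [Finset.mem_filter, Finset.mem_insert]
    constructor
    · intro hw
      rcases (hmax w hw).lt_or_eq with h1 | h1
      · exact Or.inr ⟨hw.1, h1⟩
      · exact Or.inl (hκ _ hw.1 _ hu.1 h1)
    · rintro (rfl | hw)
      · exact hu
      · exact ⟨hw.1, hw.2.trans hu.2⟩
  rw [this, Finset.card_insert_of_notMem (by simp)]

/-- General construction of hook tableaux. -/
lemma mk_hook {n : ℕ} {G : SimpleGraph (Fin n)} (c : Fin n) (A : Finset (Fin n))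
    (s : Fin n → ℕ) (hcA : c ∉ A) (hc : ∀ a ∈ A, PLt G c a)
    (hA : ∀ a ∈ A, ∀ b ∈ A, a < b → ¬ G.Adj a b)
    (hs : ∀ u, u ∉ A → ∀ v, v ∉ A → s u = s v → u = v)
    (hsc : ∀ v, v ∉ A → v ≠ c → s c < s v)
    (hC2 : ∀ u, u ∉ A → ∀ v, v ∉ A → s u < s v →
      (∀ w, w ∉ A → s u < s w → s w < s v → False) → ¬ PLt G v u) :
    ∃ g : Fin n → Fin (n + 1) × Fin (n + 1), IsHookTab G g ∧
      (∀ v, InArm g v ↔ v ∈ A) ∧ (∀ v, InLeg g v ↔ (v ∉ A ∧ v ≠ c)) ∧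
      (∀ u, u ∉ A → ∀ v, v ∉ A → (((g u).1 : ℕ) < ((g v).1 : ℕ) ↔ s u < s v)) := by
  set R : Finset (Fin n) := insert c A with hR
  set C : Finset (Fin n) := Finset.univ.filter (fun v => v ∉ A) with hC
  have mC : ∀ v, v ∈ C ↔ v ∉ A := by simp [hC]
  have mR : ∀ v, v ∈ R ↔ v = c ∨ v ∈ A := by simp [hR]
  set κ : Fin n → ℕ := fun v => (v : ℕ) with hκ
  have κinj : ∀ u v, κ u = κ v → u = v := fun u v h => Fin.ext h
  let g : Fin n → Fin (n + 1) × Fin (n + 1) := fun v =>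
    if v ∈ A then (0, ⟨idx R κ v, idx_le _ _ _⟩) else (⟨idx C s v, idx_le _ _ _⟩, 0)
  have gA1 : ∀ v, v ∈ A → ((g v).1 : ℕ) = 0 := fun v hv => by simp [g, hv]
  have gA2 : ∀ v, v ∈ A → ((g v).2 : ℕ) = idx R κ v := fun v hv => by simp [g, hv]
  have gC1 : ∀ v, v ∉ A → ((g v).1 : ℕ) = idx C s v := fun v hv => by simp [g, hv]
  have gC2 : ∀ v, v ∉ A → ((g v).2 : ℕ) = 0 := fun v hv => by simp [g, hv]
  have ic : idx C s c = 0 := by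
    unfold idx
    rw [Finset.card_eq_zero, Finset.filter_eq_empty_iff]
    intro u hu h
    by_cases huc : u = c
    · subst huc; omega
    · have := hsc u ((mC u).1 hu) huc; omega
  have ir : idx R κ c = 0 := by
    unfold idx
    rw [Finset.card_eq_zero, Finset.filter_eq_empty_iff]
    intro u hu h
    rcases (mR u).1 hu with rfl | hu
    · omega
    · have := (hc u hu).1; simp only [hκ] at h; omega
  have posC : ∀ v, v ∉ A → v ≠ c → 0 < idx C s v := fun v hv hvc => by
    have := idx_mono C s ((mC c).2 hcA) (hsc v hv hvc); omega
  have posR : ∀ v, v ∈ A → 0 < idx R κ v := fun v hv => by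
    have := idx_mono R κ (u := c) (v := v) (by simp [hR]) (hc v hv).1; omega
  have gR2 : ∀ v, ((g v).1 : ℕ) = 0 → v ∈ R ∧ ((g v).2 : ℕ) = idx R κ v := by
    intro v hv
    by_cases hvA : v ∈ A
    · exact ⟨(mR v).2 (Or.inr hvA), gA2 v hvA⟩
    · by_cases hvc : v = c
      · subst hvc; exact ⟨by simp [hR], by rw [gC2 v hvA, ir]⟩
      · have := posC v hvA hvc; rw [gC1 v hvA] at hv; omega
  have gcol : ∀ v, ((g v).2 : ℕ) = 0 → v ∉ A := fun v hv hvA => by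
    have := posR v hvA; rw [gA2 v hvA] at hv; omega
  have Rg : ∀ v, v ∈ R → ((g v).1 : ℕ) = 0 := by
    intro v hv
    rcases (mR v).1 hv with rfl | hv
    · rw [gC1 v hcA, ic]
    · exact gA1 v hv
  refine ⟨g, ⟨?_, ?_, ?_, ?_, ?_, ?_⟩, ?_, ?_, ?_⟩
  · intro u v huv
    by_cases hu : ((g u).1 : ℕ) = 0
    · have hv : ((g v).1 : ℕ) = 0 := by rw [← huv]; exact hu
      obtain ⟨a1, a2⟩ := gR2 u hu
      obtain ⟨b1, b2⟩ := gR2 v hv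
      rw [huv] at a2
      have h1 := idx_lt_iff R κ a1 b1
      have h2 := idx_lt_iff R κ b1 a1
      apply κinj; omega
    · have hu' : u ∉ A := fun h => hu (gA1 u h)
      have hv' : v ∉ A := fun h => hu (by rw [huv]; exact gA1 v h)
      have a2 := gC1 u hu'
      have b2 := gC1 v hv'
      rw [huv] at a2
      have h1 := idx_lt_iff C s ((mC u).2 hu') ((mC v).2 hv')
      have h2 := idx_lt_iff C s ((mC v).2 hv') ((mC u).2 hu')
      apply hs u hu' v hv'; omega
  · intro v
    by_cases hv : v ∈ A
    · exact Or.inl (gA1 v hv)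
    · exact Or.inr (gC2 v hv)
  · intro v h1 h2
    obtain ⟨a1, a2⟩ := gR2 v h1
    rw [a2] at h2
    obtain ⟨u, hu, hu2⟩ := idx_pred R κ (fun u _ v _ => κinj u v) h2
    exact ⟨u, Rg u hu, by rw [(gR2 u (Rg u hu)).2, a2, hu2]⟩
  · intro v h1 h2
    have hv := gcol v h1
    rw [gC1 v hv] at h2
    obtain ⟨u, hu, hu2⟩ := idx_pred C s
      (fun u hu v hv => hs u ((mC u).1 hu) v ((mC v).1 hv)) h2
    have hu' := (mC u).1 hu
    exact ⟨u, gC2 u hu', by rw [gC1 u hu', gC1 v hv, hu2]⟩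
  · intro u v hu hv huv
    obtain ⟨a1, a2⟩ := gR2 u hu
    obtain ⟨b1, b2⟩ := gR2 v hv
    have hlt : u < v := (idx_lt_iff R κ a1 b1).1 (by omega)
    refine ⟨hlt, ?_⟩
    rcases (mR v).1 b1 with rfl | hvA
    · omega
    · rcases (mR u).1 a1 with rfl | huA
      · exact (hc v hvA).2
      · exact hA u huA v hvA hlt
  · intro u v hu hv huv
    have hu' := gcol u hu
    have hv' := gcol v hv
    rw [gC1 u hu', gC1 v hv'] at huv
    have hlt := (idx_lt_iff C s ((mC u).2 hu') ((mC v).2 hv')).1 (by omega)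
    have := hC2 u hu' v hv' hlt (fun w hw h1 h2 => by
      have := idx_mono C s ((mC u).2 hu') h1
      have := idx_mono C s ((mC w).2 hw) h2
      omega)
    by_contra hcon
    push Not at hcon
    apply this
    refine ⟨lt_of_le_of_ne hcon.1 ?_, fun h => hcon.2 h.symm⟩
    rintro rfl
    omega
  · intro v
    constructor
    · intro h; by_contra hv; exact h.2 (gC2 v hv)
    · intro h; exact ⟨gA1 v h, by have := posR v h; rw [gA2 v h]; omega⟩
  · intro v
    constructor
    · intro h
      refine ⟨gcol v h.1, ?_⟩
      rintro rfl
      exact h.2 (by rw [gC1 _ hcA, ic])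
    · rintro ⟨h1, h2⟩
      exact ⟨gC2 v h1, by have := posC v h1 h2; rw [gC1 v h1]; omega⟩
  · intro u hu v hv
    rw [gC1 u hu, gC1 v hv]
    exact idx_lt_iff C s ((mC u).2 hu) ((mC v).2 hv)

section facts
variable {n : ℕ} {G : SimpleGraph (Fin n)} {f g : Fin n → Fin (n + 1) × Fin (n + 1)} {j : Fin n}

lemma IsHookTab.ext_cell (hf : IsHookTab G f) {u v : Fin n} (h1 : ((f u).1 : ℕ) = (f v).1)
    (h2 : ((f u).2 : ℕ) = (f v).2) : u = v :=
  hf.1 (Prod.ext (Fin.ext h1) (Fin.ext h2))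

lemma IsHookTab.col_of_not_arm (hf : IsHookTab G f) {v : Fin n} (h : ¬ InArm f v) :
    ((f v).2 : ℕ) = 0 := by
  rcases hf.2.1 v with h1 | h1
  · by_contra h2; exact h ⟨h1, h2⟩
  · exact h1

lemma IsHookTab.row_chain (hG : IsNUIG G) (hf : IsHookTab G f) :
    ∀ d : ℕ, ∀ u v, ((f u).1 : ℕ) = 0 → ((f v).1 : ℕ) = 0 →
      ((f v).2 : ℕ) = ((f u).2 : ℕ) + (d + 1) → PLt G u v := by
  intro d
  induction d with
  | zero => intro u v hu hv h; exact hf.2.2.2.2.1 u v hu hv h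
  | succ d ih =>
    intro u v hu hv h
    obtain ⟨w, hw1, hw2⟩ := hf.2.2.1 v hv (by omega)
    exact (ih u w hu hw1 (by omega)).trans' hG (hf.2.2.2.2.1 w v hw1 hv (by omega))

lemma IsHookTab.row_lt (hG : IsNUIG G) (hf : IsHookTab G f) {u v : Fin n}
    (hu : ((f u).1 : ℕ) = 0) (hv : ((f v).1 : ℕ) = 0) (h : ((f u).2 : ℕ) < (f v).2) :
    PLt G u v :=
  hf.row_chain hG (((f v).2 : ℕ) - (f u).2 - 1) u v hu hv (by omega)

lemma IsHookTab.row_cmp (hG : IsNUIG G) (hf : IsHookTab G f) {u v : Fin n}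
    (hu : ((f u).1 : ℕ) = 0) (hv : ((f v).1 : ℕ) = 0) (h : u ≠ v) :
    PLt G u v ∨ PLt G v u := by
  rcases lt_trichotomy ((f u).2 : ℕ) ((f v).2) with h1 | h1 | h1
  · exact Or.inl (hf.row_lt hG hu hv h1)
  · exact absurd (hf.ext_cell (by omega) h1) h
  · exact Or.inr (hf.row_lt hG hv hu h1)

lemma IsHookTab.row_fill (hf : IsHookTab G f) :
    ∀ r : ℕ, ∀ v, ((f v).1 : ℕ) = 0 → ((f v).2 : ℕ) = r → ∀ t ≤ r,
      ∃ u, ((f u).1 : ℕ) = 0 ∧ ((f u).2 : ℕ) = t := by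
  intro r
  induction r with
  | zero => intro v h1 h2 t ht; exact ⟨v, h1, by omega⟩
  | succ r ih =>
    intro v h1 h2 t ht
    rcases Nat.lt_or_ge r t with h | h
    · exact ⟨v, h1, by omega⟩
    · obtain ⟨w, hw1, hw2⟩ := hf.2.2.1 v h1 (by omega)
      exact ih w hw1 (by omega) t h

lemma IsHookTab.col_fill (hf : IsHookTab G f) :
    ∀ r : ℕ, ∀ v, ((f v).2 : ℕ) = 0 → ((f v).1 : ℕ) = r → ∀ t ≤ r,
      ∃ u, ((f u).2 : ℕ) = 0 ∧ ((f u).1 : ℕ) = t := by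
  intro r
  induction r with
  | zero => intro v h1 h2 t ht; exact ⟨v, h1, by omega⟩
  | succ r ih =>
    intro v h1 h2 t ht
    rcases Nat.lt_or_ge r t with h | h
    · exact ⟨v, h1, by omega⟩
    · obtain ⟨w, hw1, hw2⟩ := hf.2.2.2.1 v h1 (by omega)
      exact ih w hw1 (by omega) t h

lemma IsHookTab.corner (hf : IsHookTab G f) (v : Fin n) :
    ∃ c, ((f c).1 : ℕ) = 0 ∧ ((f c).2 : ℕ) = 0 := by
  rcases hf.2.1 v with h | h
  · exact hf.row_fill _ v h rfl 0 (Nat.zero_le _)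
  · obtain ⟨u, h1, h2⟩ := hf.col_fill _ v h rfl 0 (Nat.zero_le _)
    exact ⟨u, h2, h1⟩

lemma IsHookTab.no_desc (hf : IsHookTab G f) {u v : Fin n} (hu : ((f u).2 : ℕ) = 0)
    (hv : ((f v).2 : ℕ) = 0) (h : ((f v).1 : ℕ) = (f u).1 + 1) : ¬ PLt G v u := by
  intro h1
  rcases hf.2.2.2.2.2 u v hu hv h with h2 | h2
  · exact lt_asymm h1.1 h2
  · exact h1.2 h2.symm

/-- all column entries above the leg entry `j` are smaller in the poset -/
def Above (G : SimpleGraph (Fin n)) (f : Fin n → Fin (n + 1) × Fin (n + 1)) (j : Fin n) : Prop :=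
  ∀ u, ((f u).2 : ℕ) = 0 → ((f u).1 : ℕ) < (f j).1 → PLt G u j

/-- regions agree except at `j` -/
def Reg (f g : Fin n → Fin (n + 1) × Fin (n + 1)) (j : Fin n) : Prop :=
  ∀ u, u ≠ j → ((InArm f u ↔ InArm g u) ∧ (InLeg f u ↔ InLeg g u))

/-- leg orders agree except at `j` -/
def LegOrd (f g : Fin n → Fin (n + 1) × Fin (n + 1)) (j : Fin n) : Prop :=
  ∀ u u', u ≠ j → u' ≠ j → InLeg f u → InLeg f u' →
    (((f u).1 : ℕ) < ((f u').1 : ℕ) ↔ ((g u).1 : ℕ) < ((g u').1 : ℕ))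

lemma Reg.symm' (h : Reg f g j) : Reg g f j := fun u hu => ⟨(h u hu).1.symm, (h u hu).2.symm⟩

lemma Reg.col (h : Reg f g j) (hf : IsHookTab G f) (hg : IsHookTab G g) {u : Fin n} (hu : u ≠ j) :
    ((f u).2 : ℕ) = 0 ↔ ((g u).2 : ℕ) = 0 := by
  have h1 := (h u hu).1
  have h2 := hf.2.1 u
  have h3 := hg.2.1 u
  unfold InArm at h1
  tauto

lemma Reg.row (h : Reg f g j) (hf : IsHookTab G f) (hg : IsHookTab G g) {u : Fin n} (hu : u ≠ j) :
    ((f u).1 : ℕ) = 0 ↔ ((g u).1 : ℕ) = 0 := by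
  have h1 := (h u hu).2
  have h2 := hf.2.1 u
  have h3 := hg.2.1 u
  unfold InLeg at h1
  tauto

lemma LegOrd.col (hL : LegOrd f g j) (h : Reg f g j) (hf : IsHookTab G f) (hg : IsHookTab G g)
    {u v : Fin n} (hu : u ≠ j) (hv : v ≠ j) (cu : ((f u).2 : ℕ) = 0) (cv : ((f v).2 : ℕ) = 0) :
    ((f u).1 : ℕ) < (f v).1 ↔ ((g u).1 : ℕ) < (g v).1 := by
  have ru := h.row hf hg hu
  have rv := h.row hf hg hv
  by_cases h1 : ((f u).1 : ℕ) = 0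
  · have := ru.1 h1
    omega
  · by_cases h2 : ((f v).1 : ℕ) = 0
    · have := rv.1 h2; omega
    · exact hL u v hu hv ⟨cu, h1⟩ ⟨cv, h2⟩

lemma LegOrd.symm' (hL : LegOrd f g j) (h : Reg f g j) : LegOrd g f j :=
  fun u v hu hv h1 h2 => (hL u v hu hv ((h u hu).2.2 h1) ((h v hv).2.2 h2)).symm

lemma inv_eq (hf : IsHookTab G f) (hg : IsHookTab G g) (hfj : InLeg f j)
    (hgj : InArm g j) (hR : Reg f g j) (hL : LegOrd f g j) (hA : Above G f j)
    (hcmp : ∀ a, InArm f a → PLt G a j ∨ PLt G j a) : InvSet G g = InvSet G f := by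
  have nadj : ∀ u, G.Adj u j → ((f u).2 : ℕ) = 0 ∧ ((f j).1 : ℕ) < (f u).1 := by
    intro u hu
    have c : ((f u).2 : ℕ) = 0 := hf.col_of_not_arm (fun h => by
      rcases hcmp u h with h | h
      · exact h.2 hu
      · exact h.2 hu.symm)
    refine ⟨c, ?_⟩
    by_contra hlt
    rcases Nat.lt_or_ge ((f u).1 : ℕ) (f j).1 with h | h
    · exact (hA u c h).2 hu
    · exact hu.ne (hf.ext_cell (by omega) (by rw [c, hfj.1]))
  unfold InvSet
  ext ⟨a, b⟩
  simp only [Finset.mem_filter, Finset.mem_univ, true_and]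
  refine and_congr_right fun hab => and_congr_right fun hadj => ?_
  by_cases ha : a = j
  · subst ha
    have := nadj b hadj.symm
    have := hgj.1
    omega
  · by_cases hb : b = j
    · subst hb
      have := nadj a hadj
      have := hgj.1
      have := hR.row hf hg ha
      omega
    · have ra := hR.row hf hg ha
      have rb := hR.row hf hg hb
      rcases hf.2.1 a with h1 | h1
      · omega
      · rcases hf.2.1 b with h2 | h2
        · omega
        · exact (hL.col hR hf hg hb ha h2 h1).symm

lemma arm_order (hG : IsNUIG G) (hf : IsHookTab G f) (hg : IsHookTab G g) {u v : Fin n}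
    (hu : InArm f u) (hv : InArm f v) (hu' : InArm g u) (hv' : InArm g v) :
    ((f u).2 : ℕ) < (f v).2 ↔ ((g u).2 : ℕ) < (g v).2 := by
  by_cases huv : u = v
  · subst huv; simp
  constructor
  · intro h
    have h1 := hf.row_lt hG hu.1 hv.1 h
    by_contra h2
    rcases Nat.lt_or_ge ((g v).2 : ℕ) (g u).2 with h3 | h3
    · exact h1.asymm' (hg.row_lt hG hv'.1 hu'.1 h3)
    · exact huv (hg.ext_cell (by rw [hu'.1, hv'.1]) (by omega))
  · intro h
    have h1 := hg.row_lt hG hu'.1 hv'.1 h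
    by_contra h2
    rcases Nat.lt_or_ge ((f v).2 : ℕ) (f u).2 with h3 | h3
    · exact h1.asymm' (hf.row_lt hG hv.1 hu.1 h3)
    · exact huv (hf.ext_cell (by rw [hu.1, hv.1]) (by omega))

lemma moveCore_mk (hG : IsNUIG G) (hf : IsHookTab G f) (hg : IsHookTab G g) (hR : Reg f g j)
    (hL : LegOrd f g j) (hI : InvSet G g = InvSet G f) : MoveCore G f g j :=
  ⟨hg, hR, fun u v hu hv h1 h2 => arm_order hG hf hg h1 h2 ((hR u hu).1.1 h1) ((hR v hv).1.1 h2),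
    hL, hI⟩

lemma MoveCore.symm' (hG : IsNUIG G) (hf : IsHookTab G f) (h : MoveCore G f g j) :
    MoveCore G g f j :=
  moveCore_mk hG h.1 hf (Reg.symm' h.2.1) (LegOrd.symm' h.2.2.2.1 h.2.1) h.2.2.2.2.symm

lemma ArmToLeg.symm' (hG : IsNUIG G) (hf : IsHookTab G f) (h : ArmToLeg G f g j) :
    LegToArm G g f j := ⟨h.2.1, h.1, h.2.2.symm' hG hf⟩

lemma LegToArm.symm' (hG : IsNUIG G) (hf : IsHookTab G f) (h : LegToArm G f g j) :
    ArmToLeg G g f j := ⟨h.2.1, h.1, h.2.2.symm' hG hf⟩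

lemma LegToArm.cmp (hG : IsNUIG G) (h : LegToArm G f g j) {a : Fin n}
    (ha : InArm f a) : PLt G a j ∨ PLt G j a := by
  obtain ⟨hfj, hgj, hg, hR, -⟩ := h
  have haj : a ≠ j := by rintro rfl; exact ha.2 hfj.1
  exact hg.row_cmp hG ((hR a haj).1.1 ha).1 hgj.1 haj

lemma LegToArm.above (hG : IsNUIG G) (hf : IsHookTab G f) (h : LegToArm G f g j) :
    Above G f j := by
  obtain ⟨hfj, hgj, hg, hR, -, hL, hI⟩ := h
  have hR' : Reg f g j := hR
  have key : ∀ u, ((f u).2 : ℕ) = 0 → ((f u).1 : ℕ) < (f j).1 → PLt G u j ∨ PLt G j u := by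
    intro u hu hlt
    have huj : u ≠ j := by rintro rfl; omega
    by_cases hr : ((f u).1 : ℕ) = 0
    · exact hg.row_cmp hG ((hR'.row hf hg huj).1 hr) hgj.1 huj
    · have hr' : ((g u).1 : ℕ) ≠ 0 := fun h => hr ((hR'.row hf hg huj).2 h)
      have hnadj : ¬ G.Adj u j := by
        intro hadj
        rcases lt_or_gt_of_ne huj with h1 | h1
        · have : (u, j) ∈ InvSet G g := by
            simp only [InvSet, Finset.mem_filter, Finset.mem_univ, true_and]
            exact ⟨h1, hadj, by rw [hgj.1]; omega⟩
          rw [hI] at this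
          simp only [InvSet, Finset.mem_filter, Finset.mem_univ, true_and] at this
          omega
        · have : (j, u) ∈ InvSet G f := by
            simp only [InvSet, Finset.mem_filter, Finset.mem_univ, true_and]
            exact ⟨h1, hadj.symm, hlt⟩
          rw [← hI] at this
          simp only [InvSet, Finset.mem_filter, Finset.mem_univ, true_and] at this
          have := hgj.1
          omega
      rcases lt_or_gt_of_ne huj with h1 | h1
      · exact Or.inl ⟨h1, hnadj⟩
      · exact Or.inr ⟨h1, fun h => hnadj h.symm⟩
  have main : ∀ d : ℕ, ∀ u, ((f u).2 : ℕ) = 0 → ((f u).1 : ℕ) + (d + 1) = (f j).1 → PLt G u j := by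
    intro d
    induction d with
    | zero =>
      intro u hu hd
      rcases key u hu (by omega) with h | h
      · exact h
      · exact absurd h (hf.no_desc hu hfj.1 (by omega))
    | succ d ih =>
      intro u hu hd
      rcases key u hu (by omega) with h | h
      · exact h
      · obtain ⟨w, hw1, hw2⟩ := hf.col_fill _ j hfj.1 rfl ((f u).1 + 1) (by omega)
        exact absurd ((ih w hw1 (by omega)).trans' hG h) (hf.no_desc hu hw1 hw2)
  intro u hu hlt
  exact main ((f j).1 - (f u).1 - 1) u hu (by omega)

/-- construction of the move from leg to arm -/
lemma exists_legToArm (hG : IsNUIG G) (hf : IsHookTab G f) (hj : InLeg f j) (hA : Above G f j)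
    (hcmp : ∀ a, InArm f a → PLt G a j ∨ PLt G j a) : ∃ g, LegToArm G f g j := by
  obtain ⟨c, hc1, hc2⟩ := hf.corner j
  have hjarm : ¬ InArm f j := fun h => h.2 hj.1
  have hcj : c ≠ j := by rintro rfl; exact hj.2 hc1
  obtain ⟨g, hg, gA, gL, gO⟩ := mk_hook (G := G) c
    (Finset.univ.filter fun v => InArm f v ∨ v = j) (fun v => ((f v).1 : ℕ))
    (by simp only [Finset.mem_filter, Finset.mem_univ, true_and]
        rintro (h | h)
        · exact h.2 hc2
        · exact hcj h)
    (by simp only [Finset.mem_filter, Finset.mem_univ, true_and]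
        rintro a (h | rfl)
        · exact hf.row_lt hG hc1 h.1 (by have := h.2; omega)
        · exact hA c hc2 (by have := hj.2; omega))
    (by simp only [Finset.mem_filter, Finset.mem_univ, true_and]
        rintro a (ha | rfl) b (hb | rfl) hab hadj
        · rcases hf.row_cmp hG ha.1 hb.1 hab.ne with h | h
          · exact h.2 hadj
          · exact h.2 hadj.symm
        · rcases hcmp a ha with h | h
          · exact h.2 hadj
          · exact h.2 hadj.symm
        · rcases hcmp b hb with h | h
          · exact h.2 hadj.symm
          · exact h.2 hadj
        · exact lt_irrefl _ hab)
    (by simp only [Finset.mem_filter, Finset.mem_univ, true_and, not_or]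
        rintro u ⟨hu, -⟩ v ⟨hv, -⟩ h
        exact hf.ext_cell h (by rw [hf.col_of_not_arm hu, hf.col_of_not_arm hv]))
    (by simp only [Finset.mem_filter, Finset.mem_univ, true_and, not_or]
        rintro v ⟨hv, -⟩ hvc
        have := hf.col_of_not_arm hv
        rw [hc1]
        by_contra h
        exact hvc (hf.ext_cell (by omega) (by omega)))
    (by simp only [Finset.mem_filter, Finset.mem_univ, true_and, not_or]
        rintro u ⟨hu, huj⟩ v ⟨hv, hvj⟩ hlt hcons hP
        have cu := hf.col_of_not_arm hu
        have cv := hf.col_of_not_arm hv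
        obtain ⟨w, hw1, hw2⟩ := hf.col_fill _ v cv rfl ((f u).1 + 1) (by omega)
        by_cases hwv : w = v
        · subst hwv; exact hf.no_desc cu cv hw2 hP
        · have hwlt : ((f w).1 : ℕ) < (f v).1 := by
            by_contra h
            exact hwv (hf.ext_cell (by omega) (by omega))
          by_cases hwj : w = j
          · subst hwj
            have huw := hA u cu (by omega)
            obtain ⟨x, hx1, hx2⟩ := hf.col_fill _ v cv rfl ((f w).1 + 1) (by omega)
            by_cases hxv : x = v
            · subst hxv
              exact hf.no_desc hw1 hx1 hx2 (hP.trans' hG huw)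
            · have : ((f x).1 : ℕ) < (f v).1 := by
                by_contra h
                exact hxv (hf.ext_cell (by omega) (by omega))
              exact hcons x ⟨fun h => h.2 hx1, by rintro rfl; omega⟩ (by omega) this
          · exact hcons w ⟨fun h => h.2 hw1, hwj⟩ (by omega) hwlt)
  simp only [Finset.mem_filter, Finset.mem_univ, true_and] at gA gL gO
  have hgj : InArm g j := (gA j).2 (Or.inr rfl)
  have hR : Reg f g j := by
    intro u hu
    refine ⟨by rw [gA]; tauto, ?_⟩
    rw [gL]
    constructor
    · intro h
      exact ⟨by rintro (h' | h'); exacts [h'.2 h.1, hu h'], by rintro rfl; exact h.2 hc1⟩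
    · rintro ⟨h1, h2⟩
      have cu := hf.col_of_not_arm (v := u) (fun h => h1 (Or.inl h))
      exact ⟨cu, fun h => h2 (hf.ext_cell (by omega) (by omega))⟩
  have hL : LegOrd f g j := by
    intro u v hu hv h1 h2
    exact (gO u (by rintro (h' | h'); exacts [h'.2 h1.1, hu h'])
      v (by rintro (h' | h'); exacts [h'.2 h2.1, hv h'])).symm
  exact ⟨g, hj, hgj, moveCore_mk hG hf hg hR hL (inv_eq hf hg hj hgj hR hL hA hcmp)⟩

/-- construction of the move from arm to leg: always possible -/
lemma exists_armToLeg (hG : IsNUIG G) (hf : IsHookTab G f) (hj : InArm f j) :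
    ∃ g, ArmToLeg G f g j := by
  obtain ⟨c, hc1, hc2⟩ := hf.corner j
  have hcj : c ≠ j := by rintro rfl; exact hj.2 hc2
  have hcjP : PLt G c j := hf.row_lt hG hc1 hj.1 (by have := hj.2; omega)
  have hex : ∃ t : ℕ, ∀ u, ((f u).2 : ℕ) = 0 → ((f u).1 : ℕ) = t → ¬ PLt G u j :=
    ⟨n + 1, fun u _ h => by have := (f u).1.2; omega⟩
  obtain ⟨t, ht, htmin⟩ : ∃ t : ℕ, (∀ u, ((f u).2 : ℕ) = 0 → ((f u).1 : ℕ) = t → ¬ PLt G u j) ∧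
      ∀ u, ((f u).2 : ℕ) = 0 → ((f u).1 : ℕ) < t → PLt G u j := by
    refine ⟨Nat.find hex, Nat.find_spec hex, fun u hu hlt => ?_⟩
    have := Nat.find_min hex hlt
    push Not at this
    obtain ⟨w, hw1, hw2, hw3⟩ := this
    have : u = w := hf.ext_cell (by omega) (by omega)
    rw [this]; exact hw3
  have htpos : 0 < t := by
    by_contra h
    exact ht c hc2 (by omega) hcjP
  let s : Fin n → ℕ := fun v => if v = j then 2 * t - 1 else 2 * ((f v).1 : ℕ)
  have sj : s j = 2 * t - 1 := by simp [s]
  have sn : ∀ v, v ≠ j → s v = 2 * ((f v).1 : ℕ) := fun v hv => by simp [s, hv]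
  obtain ⟨g, hg, gA, gL, gO⟩ := mk_hook (G := G) c
    (Finset.univ.filter fun v => InArm f v ∧ v ≠ j) s
    (by simp only [Finset.mem_filter, Finset.mem_univ, true_and]
        exact fun h => h.1.2 hc2)
    (by simp only [Finset.mem_filter, Finset.mem_univ, true_and]
        rintro a ⟨h, -⟩
        exact hf.row_lt hG hc1 h.1 (by have := h.2; omega))
    (by simp only [Finset.mem_filter, Finset.mem_univ, true_and]
        rintro a ⟨ha, -⟩ b ⟨hb, -⟩ hab hadj
        rcases hf.row_cmp hG ha.1 hb.1 hab.ne with h | h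
        · exact h.2 hadj
        · exact h.2 hadj.symm)
    (by simp only [Finset.mem_filter, Finset.mem_univ, true_and]
        intro u hu v hv h
        by_cases huj : u = j
        · by_cases hvj : v = j
          · rw [huj, hvj]
          · rw [huj, sj, sn v hvj] at h; omega
        · by_cases hvj : v = j
          · rw [hvj, sj, sn u huj] at h; omega
          · rw [sn u huj, sn v hvj] at h
            have cu := hf.col_of_not_arm (v := u) (fun h => hu ⟨h, huj⟩)
            have cv := hf.col_of_not_arm (v := v) (fun h => hv ⟨h, hvj⟩)
            exact hf.ext_cell (by omega) (by omega))
    (by simp only [Finset.mem_filter, Finset.mem_univ, true_and]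
        intro v hv hvc
        rw [sn c hcj]
        by_cases hvj : v = j
        · rw [hvj, sj]; omega
        · rw [sn v hvj]
          have cv := hf.col_of_not_arm (v := v) (fun h => hv ⟨h, hvj⟩)
          by_contra h
          exact hvc (hf.ext_cell (by omega) (by omega)))
    (by simp only [Finset.mem_filter, Finset.mem_univ, true_and]
        intro u hu v hv hlt hcons hP
        by_cases huj : u = j
        · have hvj : v ≠ j := by rintro rfl; rw [huj] at hlt; exact lt_irrefl _ hlt
          have cv := hf.col_of_not_arm (v := v) (fun h => hv ⟨h, hvj⟩)
          subst huj
          rw [sj, sn v hvj] at hlt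
          by_cases h : ((f v).1 : ℕ) = t
          · exact ht v cv h hP
          · obtain ⟨w, hw1, hw2⟩ := hf.col_fill _ v cv rfl t (by omega)
            have hwj : w ≠ u := by rintro rfl; exact hj.2 hw1
            refine hcons w (fun h => h.1.2 hw1) ?_ ?_
            · rw [sj, sn w hwj]; omega
            · rw [sn v hvj, sn w hwj]; omega
        · have cu := hf.col_of_not_arm (v := u) (fun h => hu ⟨h, huj⟩)
          by_cases hvj : v = j
          · subst hvj
            rw [sj, sn u huj] at hlt
            exact hP.asymm' (htmin u cu (by omega))
          · have cv := hf.col_of_not_arm (v := v) (fun h => hv ⟨h, hvj⟩)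
            rw [sn u huj, sn v hvj] at hlt
            obtain ⟨w, hw1, hw2⟩ := hf.col_fill _ v cv rfl ((f u).1 + 1) (by omega)
            by_cases hwv : w = v
            · subst hwv; exact hf.no_desc cu cv hw2 hP
            · have hwj : w ≠ j := by rintro rfl; exact hj.2 hw1
              have hwlt : ((f w).1 : ℕ) < (f v).1 := by
                by_contra h
                exact hwv (hf.ext_cell (by omega) (by omega))
              refine hcons w (fun h => h.1.2 hw1) ?_ ?_
              · rw [sn u huj, sn w hwj]; omega
              · rw [sn v hvj, sn w hwj]; omega)
  simp only [Finset.mem_filter, Finset.mem_univ, true_and] at gA gL gO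
  have hgj : InLeg g j := (gL j).2 ⟨fun h => h.2 rfl, hcj.symm⟩
  have hR : Reg f g j := by
    intro u hu
    refine ⟨by rw [gA]; tauto, ?_⟩
    rw [gL]
    constructor
    · intro h
      exact ⟨fun h' => h'.1.2 h.1, by rintro rfl; exact h.2 hc1⟩
    · rintro ⟨h1, h2⟩
      have cu := hf.col_of_not_arm (v := u) (fun h => h1 ⟨h, hu⟩)
      exact ⟨cu, fun h => h2 (hf.ext_cell (by omega) (by omega))⟩
  have hL : LegOrd f g j := by
    intro u v hu hv h1 h2
    have := gO u (fun h' => h'.1.2 h1.1) v (fun h' => h'.1.2 h2.1)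
    rw [this, sn u hu, sn v hv]
    omega
  have hA : Above G g j := by
    intro u cu hlt
    have huj : u ≠ j := by rintro rfl; exact lt_irrefl _ hlt
    have cu' := (hR.col hf hg huj).2 cu
    have := (gO u (fun h' => h'.1.2 cu') j (fun h' => h'.2 rfl)).1 hlt
    rw [sn u huj, sj] at this
    exact htmin u cu' (by omega)
  have hcmp : ∀ a, InArm g a → PLt G a j ∨ PLt G j a := by
    intro a ha
    have := (gA a).1 ha
    exact hf.row_cmp hG this.1.1 hj.1 this.2
  exact ⟨g, hj, hgj, moveCore_mk hG hf hg hR hL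
    (inv_eq hg hf hgj hj hR.symm' (hL.symm' hR) hA hcmp).symm⟩

/-- hook tableaux are determined by regions and column order -/
lemma hook_ext (hG : IsNUIG G) (hf : IsHookTab G f) (hg : IsHookTab G g)
    (hA : ∀ u, InArm f u ↔ InArm g u) (hL : ∀ u, InLeg f u ↔ InLeg g u)
    (hO : ∀ u v, InLeg f u → InLeg f v → ((f u).1 : ℕ) < (f v).1 → ((g u).1 : ℕ) < (g v).1) :
    f = g := by
  have hcol : ∀ u, ((f u).2 : ℕ) = 0 ↔ ((g u).2 : ℕ) = 0 := by
    intro u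
    have h1 := hA u
    have h2 := hf.2.1 u
    have h3 := hg.2.1 u
    unfold InArm at h1
    tauto
  have hrow : ∀ u, ((f u).1 : ℕ) = 0 ↔ ((g u).1 : ℕ) = 0 := by
    intro u
    have h1 := hL u
    have h2 := hf.2.1 u
    have h3 := hg.2.1 u
    unfold InLeg at h1
    tauto
  have mcol : ∀ u v, ((f u).2 : ℕ) = 0 → ((f v).2 : ℕ) = 0 → ((f u).1 : ℕ) < (f v).1 →
      ((g u).1 : ℕ) < (g v).1 := by
    intro u v cu cv h
    have ru := hrow u
    have rv := hrow v
    by_cases h1 : ((f u).1 : ℕ) = 0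
    · omega
    · exact hO u v ⟨cu, h1⟩ ⟨cv, by omega⟩ h
  have mrow : ∀ u v, ((f u).1 : ℕ) = 0 → ((f v).1 : ℕ) = 0 → ((f u).2 : ℕ) < (f v).2 →
      ((g u).2 : ℕ) < (g v).2 := by
    intro u v ru rv h
    have cu := hcol u
    have cv := hcol v
    by_cases h1 : ((f u).2 : ℕ) = 0
    · omega
    · have au : InArm f u := ⟨ru, h1⟩
      have av : InArm f v := ⟨rv, by omega⟩
      exact (arm_order hG hf hg au av ((hA u).1 au) ((hA v).1 av)).1 h
  have ecol : ∀ r : ℕ, ∀ v, ((f v).2 : ℕ) = 0 → ((f v).1 : ℕ) = r → ((g v).1 : ℕ) = r := by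
    intro r
    induction r using Nat.strong_induction_on with
    | _ r ih =>
      intro v cv hv
      by_cases h0 : r = 0
      · have := (hrow v).1 (by omega); omega
      obtain ⟨u, hu1, hu2⟩ := hf.col_fill _ v cv rfl (r - 1) (by omega)
      have h1 := ih (r - 1) (by omega) u hu1 hu2
      have h2 := mcol u v hu1 cv (by omega)
      by_contra hne
      obtain ⟨w, hw1, hw2⟩ := hg.col_fill _ v ((hcol v).1 cv) rfl r (by omega)
      have cw := (hcol w).2 hw1
      rcases lt_trichotomy ((f w).1 : ℕ) r with h | h | h
      · have := ih _ h w cw rfl; omega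
      · have : w = v := hf.ext_cell (by omega) (by omega)
        subst this; omega
      · have := mcol v w cv cw (by omega); omega
  have erow : ∀ r : ℕ, ∀ v, ((f v).1 : ℕ) = 0 → ((f v).2 : ℕ) = r → ((g v).2 : ℕ) = r := by
    intro r
    induction r using Nat.strong_induction_on with
    | _ r ih =>
      intro v cv hv
      by_cases h0 : r = 0
      · have := (hcol v).1 (by omega); omega
      obtain ⟨u, hu1, hu2⟩ := hf.row_fill _ v cv rfl (r - 1) (by omega)
      have h1 := ih (r - 1) (by omega) u hu1 hu2
      have h2 := mrow u v hu1 cv (by omega)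
      by_contra hne
      obtain ⟨w, hw1, hw2⟩ := hg.row_fill _ v ((hrow v).1 cv) rfl r (by omega)
      have cw := (hrow w).2 hw1
      rcases lt_trichotomy ((f w).2 : ℕ) r with h | h | h
      · have := ih _ h w cw rfl; omega
      · have : w = v := hf.ext_cell (by omega) (by omega)
        subst this; omega
      · have := mrow v w cv cw (by omega); omega
  funext v
  rcases hf.2.1 v with h | h
  · exact Prod.ext (Fin.ext (by rw [h, (hrow v).1 h])) (Fin.ext (erow _ v h rfl).symm)
  · exact Prod.ext (Fin.ext (ecol _ v h rfl).symm) (Fin.ext (by rw [h, (hcol v).1 h]))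

lemma LegToArm.unique (hG : IsNUIG G) {g' : Fin n → Fin (n + 1) × Fin (n + 1)}
    (h : LegToArm G f g j) (h' : LegToArm G f g' j) : g = g' := by
  obtain ⟨hfj, hgj, hg, hR, -, hL, -⟩ := h
  obtain ⟨-, hgj', hg', hR', -, hL', -⟩ := h'
  have nl : ∀ {e : Fin n → Fin (n + 1) × Fin (n + 1)}, InArm e j → ¬ InLeg e j :=
    fun h1 h2 => h1.2 h2.1
  apply hook_ext hG hg hg'
  · intro u
    by_cases hu : u = j
    · subst hu; exact ⟨fun _ => hgj', fun _ => hgj⟩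
    · rw [← (hR u hu).1, ← (hR' u hu).1]
  · intro u
    by_cases hu : u = j
    · subst hu; exact ⟨fun h => absurd h (nl hgj), fun h => absurd h (nl hgj')⟩
    · rw [← (hR u hu).2, ← (hR' u hu).2]
  · intro u v hu hv hlt
    have huj : u ≠ j := by rintro rfl; exact nl hgj hu
    have hvj : v ≠ j := by rintro rfl; exact nl hgj hv
    have lu := (hR u huj).2.2 hu
    have lv := (hR v hvj).2.2 hv
    exact (hL' u v huj hvj lu lv).1 ((hL u v huj hvj lu lv).2 hlt)

lemma ArmToLeg.unique (hG : IsNUIG G) (hf : IsHookTab G f)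
    {g' : Fin n → Fin (n + 1) × Fin (n + 1)}
    (h : ArmToLeg G f g j) (h' : ArmToLeg G f g' j) : g = g' := by
  have ab := (h.symm' hG hf).above hG h.2.2.1
  have ab' := (h'.symm' hG hf).above hG h'.2.2.1
  obtain ⟨hfj, hgj, hg, hR, -, hL, -⟩ := h
  obtain ⟨-, hgj', hg', hR', -, hL', -⟩ := h'
  have nl : ∀ {e : Fin n → Fin (n + 1) × Fin (n + 1)}, InLeg e j → ¬ InArm e j :=
    fun h1 h2 => h2.2 h1.1
  -- transfer of order away from `j`
  have tr : ∀ {e e' : Fin n → Fin (n + 1) × Fin (n + 1)}, IsHookTab G e → IsHookTab G e' →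
      Reg f e j → Reg f e' j → LegOrd f e j → LegOrd f e' j →
      ∀ u v, u ≠ j → v ≠ j → ((e u).2 : ℕ) = 0 → ((e v).2 : ℕ) = 0 →
      ((e u).1 : ℕ) < (e v).1 → ((e' u).1 : ℕ) < (e' v).1 := by
    intro e e' he he' r r' l l' u v hu hv cu cv hlt
    have fu := (r.col hf he hu).2 cu
    have fv := (r.col hf he hv).2 cv
    exact (l'.col r' hf he' hu hv fu fv).1 ((l.col r hf he hu hv fu fv).2 hlt)
  -- an entry cannot be above `j` in one and below in the other
  have key : ∀ {e e' : Fin n → Fin (n + 1) × Fin (n + 1)}, IsHookTab G e → IsHookTab G e' →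
      Reg f e j → Reg f e' j → LegOrd f e j → LegOrd f e' j → Above G e j →
      InLeg e' j →
      ∀ u, u ≠ j → ((e u).2 : ℕ) = 0 → ((e u).1 : ℕ) < (e j).1 → ((e' u).1 : ℕ) < (e' j).1 := by
    intro e e' he he' r r' l l' a hj' u hu cu hlt
    have cu' := (r'.col hf he' hu).1 ((r.col hf he hu).2 cu)
    by_contra hge
    have hgt : ((e' j).1 : ℕ) < (e' u).1 := by
      by_contra h
      exact hu (he'.ext_cell (by omega) (by rw [cu', hj'.1]))
    obtain ⟨v, hv1, hv2⟩ := he'.col_fill _ u cu' rfl ((e' j).1 + 1) (by omega)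
    have hvj : v ≠ j := by rintro rfl; omega
    have cv := (r.col hf he hvj).1 ((r'.col hf he' hvj).2 hv1)
    have hvlt : ((e v).1 : ℕ) < (e j).1 := by
      by_cases hvu : v = u
      · subst hvu; exact hlt
      · have : ((e' v).1 : ℕ) < (e' u).1 := by
          by_contra h
          exact hvu (he'.ext_cell (by omega) (by omega))
        exact (tr he' he r' r l' l v u hvj hu hv1 cu' this).trans hlt
    exact he'.no_desc hj'.1 hv1 hv2 (a v cv hvlt)
  apply hook_ext hG hg hg'
  · intro u
    by_cases hu : u = j
    · subst hu; exact ⟨fun h => absurd h (nl hgj), fun h => absurd h (nl hgj')⟩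
    · rw [← (hR u hu).1, ← (hR' u hu).1]
  · intro u
    by_cases hu : u = j
    · subst hu; exact ⟨fun _ => hgj', fun _ => hgj⟩
    · rw [← (hR u hu).2, ← (hR' u hu).2]
  · intro u v hu hv hlt
    by_cases huj : u = j
    · have hvj : v ≠ j := by rintro rfl; rw [huj] at hlt; exact lt_irrefl _ hlt
      subst huj
      have cv' := ((hR' v hvj).2.1 ((hR v hvj).2.2 hv)).1
      by_contra hge
      have : ((g' v).1 : ℕ) < (g' u).1 := by
        by_contra h
        exact hvj (hg'.ext_cell (by omega) (by rw [cv', hgj'.1]))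
      have := key hg' hg hR' hR hL' hL ab' hgj v hvj cv' this
      omega
    · by_cases hvj : v = j
      · subst hvj
        exact key hg hg' hR hR' hL hL' ab hgj' u huj hu.1 hlt
      · exact tr hg hg' hR hR' hL hL' u v huj hvj hu.1 hv.1 hlt

/-- one move in either direction -/
def Move (G : SimpleGraph (Fin n)) (f g : Fin n → Fin (n + 1) × Fin (n + 1)) (j : Fin n) : Prop :=
  ArmToLeg G f g j ∨ LegToArm G f g j

lemma Move.symm' (hG : IsNUIG G) (hf : IsHookTab G f) (h : Move G f g j) : Move G g f j :=
  h.elim (fun h => Or.inr (h.symm' hG hf)) (fun h => Or.inl (h.symm' hG hf))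

lemma Move.unique (hG : IsNUIG G) (hf : IsHookTab G f) {g' : Fin n → Fin (n + 1) × Fin (n + 1)}
    (h : Move G f g j) (h' : Move G f g' j) : g = g' := by
  rcases h with h | h <;> rcases h' with h' | h'
  · exact h.unique hG hf h'
  · exact absurd h'.1.1 h.1.2
  · exact absurd h.1.1 h'.1.2
  · exact h.unique hG h'

lemma Move.movable (h : Move G f g j) : MovableEntry G f j :=
  h.elim (fun h => Or.inl ⟨g, h⟩) (fun h => Or.inr ⟨g, h⟩)

lemma movable_of_move (hG : IsNUIG G) (hf : IsHookTab G f) (h : Move G f g j) {k : Fin n}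
    (hk : MovableEntry G g k) : MovableEntry G f k := by
  by_cases hkj : k = j
  · subst hkj; exact h.movable
  have hC : MoveCore G f g j := h.elim (fun h => h.2.2) (fun h => h.2.2)
  obtain ⟨hg, hR, -, hL, -⟩ := hC
  have hR' : Reg f g j := hR
  have hL' : LegOrd f g j := hL
  rcases hk with ⟨e, he⟩ | ⟨e, he⟩
  · exact Or.inl (exists_armToLeg hG hf ((hR k hkj).1.2 he.1))
  have ab := he.above hG hg
  have kl : InLeg f k := (hR k hkj).2.2 he.1
  right
  have hab : ∀ u, u ≠ j → ((f u).2 : ℕ) = 0 → ((f u).1 : ℕ) < (f k).1 → PLt G u k := by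
    intro u hu cu hlt
    exact ab u ((hR'.col hf hg hu).1 cu) ((hL'.col hR' hf hg hu hkj cu kl.1).1 hlt)
  rcases h with h | h
  · refine exists_legToArm hG hf kl ?_ ?_
    · intro u cu hlt
      exact hab u (by rintro rfl; exact h.1.2 cu) cu hlt
    · intro a ha
      by_cases haj : a = j
      · subst haj
        have ab2 := (h.symm' hG hf).above hG hg
        rcases lt_trichotomy ((g k).1 : ℕ) ((g a).1) with h1 | h1 | h1
        · exact Or.inr (ab2 k he.1.1 h1)
        · exact absurd (hg.ext_cell h1 (by rw [he.1.1, h.2.1.1])) hkj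
        · exact Or.inl (ab a h.2.1.1 h1)
      · exact he.cmp hG ((hR a haj).1.1 ha)
  · refine exists_legToArm hG hf kl ?_ ?_
    · intro u cu hlt
      by_cases huj : u = j
      · subst huj
        rcases he.cmp hG h.2.1 with h1 | h1
        · exact h1
        · exfalso
          obtain ⟨v, hv1, hv2⟩ := hf.col_fill _ k kl.1 rfl ((f u).1 + 1) (by omega)
          apply hf.no_desc cu hv1 hv2
          by_cases hvk : v = k
          · subst hvk; exact h1
          · have : ((f v).1 : ℕ) < (f k).1 := by
              by_contra h'
              have := kl.1
              exact hvk (hf.ext_cell (by omega) (by omega))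
            exact (hab v (by rintro rfl; omega) hv1 this).trans' hG h1
      · exact hab u huj cu hlt
    · intro a ha
      have haj : a ≠ j := by rintro rfl; exact ha.2 h.1.1
      exact he.cmp hG ((hR a haj).1.1 ha)

lemma movable_iff_of_move (hG : IsNUIG G) (hf : IsHookTab G f) (hg : IsHookTab G g)
    (h : Move G f g j) (k : Fin n) : MovableEntry G g k ↔ MovableEntry G f k :=
  ⟨movable_of_move hG hf h, movable_of_move hG hg (h.symm' hG hf)⟩

end facts

lemma phi_fixed {n : ℕ} {G : SimpleGraph (Fin n)} (T : HT n G)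
    (h : ∀ j, ¬ MovableEntry G T.1 j) : phi T = T := by
  unfold phi
  rw [dif_neg]
  rintro ⟨j, hj⟩
  exact h j (Finset.mem_filter.mp hj).2

lemma phi_move {n : ℕ} {G : SimpleGraph (Fin n)} (T : HT n G)
    (h : ∃ j, MovableEntry G T.1 j) :
    ∃ j, Move G T.1 (phi T).1 j ∧ ∀ k, MovableEntry G T.1 k → j ≤ k := by
  have hne : (Finset.univ.filter fun j : Fin n => MovableEntry G T.1 j).Nonempty := by
    obtain ⟨j, hj⟩ := h
    exact ⟨j, by simp [hj]⟩
  refine ⟨(Finset.univ.filter fun j : Fin n => MovableEntry G T.1 j).min' hne, ?_, ?_⟩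
  · have hj : MovableEntry G T.1
        ((Finset.univ.filter fun j : Fin n => MovableEntry G T.1 j).min' hne) :=
      (Finset.mem_filter.mp (Finset.min'_mem _ hne)).2
    have : (phi T).1 = Classical.choose hj.exists_tab := by
      unfold phi
      rw [dif_pos hne]
    rw [this]
    exact (Classical.choose_spec hj.exists_tab).2
  · intro k hk
    exact Finset.min'_le _ _ (by simp [hk])

lemma armCard_move {n : ℕ} {G : SimpleGraph (Fin n)} (T S : HT n G) {j : Fin n}
    (h : ArmToLeg G T.1 S.1 j) : armCard T = armCard S + 1 := by
  unfold armCard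
  have : (Finset.univ.filter fun v => InArm T.1 v)
      = insert j (Finset.univ.filter fun v => InArm S.1 v) := by
    ext v
    simp only [Finset.mem_filter, Finset.mem_univ, true_and, Finset.mem_insert]
    by_cases hv : v = j
    · subst hv; simp [h.1]
    · simp [hv, (h.2.2.2.1 v hv).1]
  rw [this, Finset.card_insert_of_notMem]
  simp only [Finset.mem_filter, Finset.mem_univ, true_and]
  exact fun h' => h'.2 h.2.1.1

/-- `φ_G` is an involution on hook `G`-tableaux preserving the
number of inversions; its fixed points have column shape `1^n` and sign `1`,
and it reverses the sign of every non-fixed tableau. -/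
theorem stmt14 (n : ℕ) (G : SimpleGraph (Fin n)) (hG : IsNUIG G) (T : HT n G) :
    phi (phi T) = T ∧
    tabInv G (phi T) = tabInv G T ∧
    (phi T = T → (∀ v, ¬ InArm T.1 v) ∧ tabSign T = 1) ∧
    (phi T ≠ T → tabSign (phi T) = - tabSign T) := by
  by_cases hm : ∃ j, MovableEntry G T.1 j
  · obtain ⟨j, hj, hmin⟩ := phi_move T hm
    have hne : phi T ≠ T := by
      intro heq
      rw [heq] at hj
      rcases hj with h | h
      · exact h.1.2 h.2.1.1
      · exact h.2.1.2 h.1.1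
    have hiff := movable_iff_of_move hG T.2 (phi T).2 hj
    obtain ⟨j', hj', hmin'⟩ := phi_move (phi T) ⟨j, (hiff j).2 hj.movable⟩
    have hjj : j' = j := le_antisymm (hmin' j ((hiff j).2 hj.movable))
      (hmin j' ((hiff j').1 hj'.movable))
    subst hjj
    refine ⟨Subtype.ext (hj'.unique hG (phi T).2 (hj.symm' hG T.2)), ?_,
      fun h => absurd h hne, fun _ => ?_⟩
    · unfold tabInv
      rcases hj with h | h
      · rw [h.2.2.2.2.2.2]
      · rw [h.2.2.2.2.2.2]
    · unfold tabSign
      rcases hj with h | h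
      · rw [armCard_move T (phi T) h, pow_succ]; ring
      · rw [armCard_move (phi T) T (h.symm' hG T.2), pow_succ]; ring
  · push Not at hm
    have hfix := phi_fixed T hm
    have harm : ∀ v, ¬ InArm T.1 v := fun v hv => hm v (Or.inl (exists_armToLeg hG T.2 hv))
    refine ⟨by rw [hfix, hfix], by rw [hfix], fun _ => ⟨harm, ?_⟩, fun h => absurd hfix h⟩
    unfold tabSign armCard
    rw [Finset.filter_false_of_mem (fun v _ => harm v)]
    simp
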